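/- arXiv:2301.12159 — 2 statements merged into one kernel-verified Lean document; each statement's English description precedes it below -/
import Mathlib

section
/- Let V be a finite set, f : V → ℝ^d, and let i, j ∈ V be distinct nodes with k-nearest-neighbour sets N_i ⊆ V \ {i} and N_j ⊆ V \ {j} (nonempty), i.e., ⟨f_i, f_{p'}⟩ ≤ min_{p ∈ N_i} ⟨f_i, f_p⟩ for every p' ∈ V \ (N_i ∪ {i}) and analogously for j. Set b_{ij} := min_{p ∈ N_i} ⟨f_i, f_p⟩ + min_{q ∈ N_j} ⟨f_j, f_q⟩, f_m := f_i + f_j, and N_{ij} := (N_i ∪ N_j) \ {i, j}. If at least k elements p of N_{ij} satisfy ⟨f_m, f_p⟩ ≥ b_{ij}, then there exists a subset S ⊆ N_{ij} with |S| = k such that ⟨f_m, f_v⟩ ≤ min_{p ∈ S} ⟨f_m, f_p⟩ for every v ∈ V \ (S ∪ {i, j}); that is, a set of k-nearest neighbours of the contracted node m among V \ {i, j} can be chosen entirely from N_{ij}. (Lemma 3.5.) -/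
open scoped Classical

/-- A finset with at least `k` elements has a subset of `k` elements on which `g` is largest. -/
theorem Finset.exists_subset_card_eq_forall_le {α β : Type*} [LinearOrder β]
    (F : Finset α) (g : α → β) {k : ℕ} (hk : k ≤ F.card) :
    ∃ S ⊆ F, S.card = k ∧ ∀ v ∈ F, v ∉ S → ∀ p ∈ S, g v ≤ g p := by
  classical
  induction k with
  | zero => exact ⟨∅, by simp⟩
  | succ k ih =>
    obtain ⟨S, hSF, hcard, hS⟩ := ih (by omega)
    have hne : (F \ S).Nonempty := by
      rw [← Finset.card_pos, Finset.card_sdiff_of_subset hSF]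
      omega
    obtain ⟨m, hm, hmax⟩ := Finset.exists_max_image (F \ S) g hne
    obtain ⟨hmF, hmS⟩ := Finset.mem_sdiff.mp hm
    refine ⟨insert m S, Finset.insert_subset hmF hSF, ?_, ?_⟩
    · rw [Finset.card_insert_of_notMem hmS, hcard]
    · intro v hvF hv p hp
      have hvS : v ∉ S := fun h => hv (Finset.mem_insert_of_mem h)
      rcases Finset.mem_insert.mp hp with rfl | hpS
      · exact hmax v (Finset.mem_sdiff.mpr ⟨hvF, hvS⟩)
      · exact hS v hvF hvS p hpS

/-- Lemma 3.5: with `b_{ij}` the incremental bound of Proposition 3.4,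
`f_m = f_i + f_j` and `N_{ij} = (N_i ∪ N_j) \ {i, j}`, if at least `k` elements
`p` of `N_{ij}` satisfy `⟨f_m, f_p⟩ ≥ b_{ij}`, then a set of k-nearest
neighbours of the contracted node `m` among `V \ {i, j}` can be chosen from
`N_{ij}`: there is `S ⊆ N_{ij}` with `|S| = k` such that every node outside
`S ∪ {i, j}` has similarity to `m` at most `min_{p ∈ S} ⟨f_m, f_p⟩`. -/
theorem knn_of_contracted_node_from_union
    {V : Type*} [Fintype V] [DecidableEq V] (d : ℕ) (k : ℕ)
    (f : V → EuclideanSpace ℝ (Fin d)) (i j : V) (hij : i ≠ j)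
    (Ni Nj : Finset V) (hNi : Ni.Nonempty) (hNj : Nj.Nonempty)
    (hNii : i ∉ Ni) (hNjj : j ∉ Nj)
    (hmini : ∀ p' : V, p' ∉ Ni → p' ≠ i →
      (inner ℝ (f i) (f p') : ℝ) ≤ Ni.inf' hNi (fun p => (inner ℝ (f i) (f p) : ℝ)))
    (hminj : ∀ q' : V, q' ∉ Nj → q' ≠ j →
      (inner ℝ (f j) (f q') : ℝ) ≤ Nj.inf' hNj (fun q => (inner ℝ (f j) (f q) : ℝ)))
    (hk : k ≤ (((Ni ∪ Nj) \ {i, j}).filter (fun p =>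
      Ni.inf' hNi (fun p' => (inner ℝ (f i) (f p') : ℝ)) +
        Nj.inf' hNj (fun q' => (inner ℝ (f j) (f q') : ℝ)) ≤
          (inner ℝ (f i + f j) (f p) : ℝ))).card) :
    ∃ S : Finset V, S ⊆ (Ni ∪ Nj) \ {i, j} ∧ S.card = k ∧
      ∀ v : V, v ∉ S → v ≠ i → v ≠ j → ∀ p ∈ S,
        (inner ℝ (f i + f j) (f v) : ℝ) ≤ (inner ℝ (f i + f j) (f p) : ℝ) := by
  obtain ⟨S, hSF, hcard, hS⟩ := Finset.exists_subset_card_eq_forall_le _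
    (fun v => (inner ℝ (f i + f j) (f v) : ℝ)) hk
  refine ⟨S, hSF.trans (Finset.filter_subset _ _), hcard, ?_⟩
  intro v hvS hvi hvj p hp
  have hbp := (Finset.mem_filter.mp (hSF hp)).2
  by_cases hvN : v ∈ Ni ∪ Nj
  · rcases le_total (inner ℝ (f i + f j) (f v) : ℝ)
      (Ni.inf' hNi (fun p' => (inner ℝ (f i) (f p') : ℝ)) +
        Nj.inf' hNj (fun q' => (inner ℝ (f j) (f q') : ℝ))) with hle | hge
    · exact hle.trans hbp
    · exact hS v (Finset.mem_filter.mpr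
        ⟨Finset.mem_sdiff.mpr ⟨hvN, by simp [hvi, hvj]⟩, hge⟩) hvS p hp
  · rw [Finset.mem_union, not_or] at hvN
    refine le_trans ?_ hbp
    rw [inner_add_left]
    exact add_le_add (hmini v hvN.1 hvi) (hminj v hvN.2 hvj)
end

section
/- Let V be a finite set, f : V → ℝ^d, q ∈ V, and let N ⊆ V \ {q} with |N| = k be a set of k-nearest neighbours of q, i.e., ⟨f_q, f_v⟩ ≤ min_{l ∈ N} ⟨f_q, f_l⟩ for every v ∈ V \ (N ∪ {q}). Let i, j ∈ V \ {q} be distinct nodes with i ∈ N, and let m be a new node (m ∉ V) with feature f_m = f_i + f_j obtained by contracting i and j, so that the contracted node set is V' = (V \ {i, j}) ∪ {m}. If ⟨f_q, f_m⟩ ≥ min_{l ∈ N} ⟨f_q, f_l⟩, then m is a k-nearest neighbour of q in V': the number of nodes v ∈ V' \ {q} with ⟨f_q, f_v⟩ > ⟨f_q, f_m⟩ is at most k − 1. (Correctness of the incremental nearest-neighbour membership check in Algorithm 3: if a contracting node was a k-nearest neighbour of q and the merged node's similarity to q is at least the minimum similarity among q's current nearest neighbours, then the merged node is a k-nearest neighbour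 of q, without exhaustive search.) -/
open scoped Classical

/-- Correctness of the incremental nearest-neighbour membership check of
Algorithm 3: let `N` be a set of k-nearest neighbours of `q` (of size `k`) in the
node set `VS`, let `i ∈ N` and `j` be distinct nodes (both `≠ q`) that are
contracted to a new node `m ∉ VS` with `f_m = f_i + f_j`, and let
`V' = (VS \ {i, j}) ∪ {m}`. If `⟨f_q, f_m⟩ ≥ min_{l ∈ N} ⟨f_q, f_l⟩`, then `m`
is a k-nearest neighbour of `q` in `V'`: at most `k − 1` nodes of `V' \ {q}`
are strictly more similar to `q` than `m`. -/
theorem incremental_nn_membership_check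
    {U : Type*} [DecidableEq U] (d : ℕ) (f : U → EuclideanSpace ℝ (Fin d))
    (VS : Finset U) (q : U) (hq : q ∈ VS) (k : ℕ)
    (N : Finset U) (hNV : N ⊆ VS) (hqN : q ∉ N) (hcard : N.card = k)
    (i j : U) (hi : i ∈ VS) (hj : j ∈ VS) (hij : i ≠ j)
    (hiq : i ≠ q) (hjq : j ≠ q) (hiN : i ∈ N)
    (hknn : ∀ v ∈ VS, v ∉ N → v ≠ q →
      (inner ℝ (f q) (f v) : ℝ) ≤ N.inf' ⟨i, hiN⟩ (fun l => (inner ℝ (f q) (f l) : ℝ)))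
    (m : U) (hm : m ∉ VS) (hfm : f m = f i + f j)
    (hcheck : N.inf' ⟨i, hiN⟩ (fun l => (inner ℝ (f q) (f l) : ℝ)) ≤
      (inner ℝ (f q) (f m) : ℝ)) :
    (((insert m (VS \ {i, j})).erase q).filter
        (fun v => (inner ℝ (f q) (f m) : ℝ) < (inner ℝ (f q) (f v) : ℝ))).card
      ≤ k - 1 := by
  rw [← hcard, ← Finset.card_erase_of_mem hiN]
  refine Finset.card_le_card fun v hv => ?_
  simp only [Finset.mem_filter, Finset.mem_erase, Finset.mem_insert, Finset.mem_sdiff,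
    Finset.mem_singleton, not_or] at hv
  obtain ⟨⟨hvq, rfl | ⟨hvV, hvi, -⟩⟩, hlt⟩ := hv
  · exact absurd hlt (lt_irrefl _)
  · refine Finset.mem_erase.mpr ⟨hvi, ?_⟩
    by_contra hvN
    exact absurd hlt (not_lt.mpr ((hknn v hvV hvN hvq).trans hcheck))
end
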